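/- arXiv:2003.11749 — 2 statements merged into one kernel-verified Lean document; each statement's English description precedes it below -/
import Mathlib

section
/- For every integer r ≥ 1, the odd binomial moments of the inversion number satisfy lim_{n→∞} B_{2r+1}(n) · (r−1)! · 72^r / n^{3r} = −1; that is, B_{2r+1}(n) = −n^{3r}/((r−1)! · 2^{3r} · 3^{2r}) plus lower order terms in n. -/
open Finset Filter

/-- The inversion number of a permutation of `Fin n`: the number of pairs `(i, j)` with
`i < j` and `π i > π j`. -/
def invNum {n : ℕ} (π : Equiv.Perm (Fin n)) : ℕ :=
  ((univ : Finset (Fin n × Fin n)).filter (fun p => p.1 < p.2 ∧ π p.2 < π p.1)).card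

/-- The `s`-th binomial moment of the centralized inversion number over `S_n`:
`B_s(n) = (1/n!) Σ_{π ∈ S_n} (1/s!) ∏_{j=0}^{s−1} (inv(π) − n(n−1)/4 − j)`. -/
noncomputable def invBinomMoment (s n : ℕ) : ℝ :=
  (1 / (n.factorial : ℝ)) * ∑ π : Equiv.Perm (Fin n),
    (1 / (s.factorial : ℝ)) * ∏ j ∈ Finset.range s,
      ((invNum π : ℝ) - (n : ℝ) * ((n : ℝ) - 1) / 4 - (j : ℝ))

/-- The permutation of `Fin (n + 1)` with first value `k` whose remaining values are in the
relative order prescribed by `e`. -/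
def permCons {n : ℕ} (k : Fin (n + 1)) (e : Equiv.Perm (Fin n)) : Equiv.Perm (Fin (n + 1)) :=
  ((finSuccEquiv' 0).trans (Equiv.optionCongr e)).trans (finSuccEquiv' k).symm

@[simp]
theorem permCons_zero {n : ℕ} (k : Fin (n + 1)) (e : Equiv.Perm (Fin n)) :
    permCons k e 0 = k := by
  simp [permCons]

@[simp]
theorem permCons_succ {n : ℕ} (k : Fin (n + 1)) (e : Equiv.Perm (Fin n)) (i : Fin n) :
    permCons k e i.succ = k.succAbove (e i) := by
  have h : finSuccEquiv' (0 : Fin (n + 1)) i.succ = some i := by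
    rw [← Fin.succAbove_zero, finSuccEquiv'_succAbove]
  simp [permCons, h]

theorem permCons_bijective (n : ℕ) :
    Function.Bijective (fun p : Fin (n + 1) × Equiv.Perm (Fin n) => permCons p.1 p.2) := by
  rw [Fintype.bijective_iff_injective_and_card]
  refine ⟨?_, by simp [Fintype.card_perm, Nat.factorial_succ]⟩
  rintro ⟨k, e⟩ ⟨k', e'⟩ h
  simp only at h
  have hk : k = k' := by simpa using DFunLike.congr_fun h 0
  subst hk
  refine Prod.ext rfl (Equiv.ext fun i => ?_)
  have hi := DFunLike.congr_fun h i.succ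
  simpa using hi

theorem card_filter_succAbove_lt {n : ℕ} (k : Fin (n + 1)) :
    (univ.filter fun i : Fin n => k.succAbove i < k).card = k := by
  have h : (univ.filter fun i : Fin n => k.succAbove i < k)
      = univ.filter fun i : Fin n => (i : ℕ) < k := by
    ext i
    simp only [mem_filter, mem_univ, true_and, Fin.succAbove_lt_iff_castSucc_lt]
    rfl
  rw [h, Fin.card_filter_val_lt]
  have := k.is_lt
  omega

theorem invNum_eq_sum {n : ℕ} (π : Equiv.Perm (Fin n)) :
    invNum π = ∑ i, ∑ j, if i < j ∧ π j < π i then 1 else 0 := by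
  rw [invNum, card_filter, ← univ_product_univ, sum_product]

theorem invNum_permCons {n : ℕ} (k : Fin (n + 1)) (e : Equiv.Perm (Fin n)) :
    invNum (permCons k e) = k + invNum e := by
  rw [invNum_eq_sum, Fin.sum_univ_succ, invNum_eq_sum]
  congr 1
  · rw [Fin.sum_univ_succ]
    simp only [lt_irrefl, false_and, if_false, zero_add, Fin.succ_pos, true_and, permCons_zero,
      permCons_succ]
    rw [Equiv.sum_comp e fun i => if k.succAbove i < k then 1 else 0, ← card_filter,
      card_filter_succAbove_lt]
  · refine sum_congr rfl fun i _ => ?_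
    rw [Fin.sum_univ_succ]
    simp [Fin.succAbove_lt_succAbove_iff]

theorem sum_perm_succ {n : ℕ} (f : ℕ → ℝ) :
    ∑ π : Equiv.Perm (Fin (n + 1)), f (invNum π)
      = ∑ k ∈ range (n + 1), ∑ e : Equiv.Perm (Fin n), f (k + invNum e) := by
  rw [← (permCons_bijective n).sum_comp fun π => f (invNum π), ← univ_product_univ, sum_product,
    ← Fin.sum_univ_eq_sum_range fun k => ∑ e : Equiv.Perm (Fin n), f (k + invNum e)]
  simp only [invNum_permCons]

/-- The central moments of the inversion number over `S_n`. -/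
noncomputable def invMoment (s n : ℕ) : ℝ :=
  (1 / (n.factorial : ℝ)) * ∑ π : Equiv.Perm (Fin n),
    ((invNum π : ℝ) - (n : ℝ) * ((n : ℝ) - 1) / 4) ^ s

/-- The central moments of the uniform distribution on `{0, …, n}`. -/
noncomputable def uniformMoment (s n : ℕ) : ℝ :=
  (1 / ((n : ℝ) + 1)) * ∑ k ∈ range (n + 1), ((k : ℝ) - n / 2) ^ s

theorem invMoment_succ (s n : ℕ) :
    invMoment s (n + 1)
      = ∑ j ∈ range (s + 1), (s.choose j : ℝ) * invMoment j n * uniformMoment (s - j) n := by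
  have h : ∑ π : Equiv.Perm (Fin (n + 1)),
      ((invNum π : ℝ) - ((n + 1 : ℕ) : ℝ) * (((n + 1 : ℕ) : ℝ) - 1) / 4) ^ s
      = ∑ k ∈ range (n + 1), ∑ e : Equiv.Perm (Fin n), ∑ j ∈ range (s + 1),
        ((invNum e : ℝ) - (n : ℝ) * ((n : ℝ) - 1) / 4) ^ j * ((k : ℝ) - n / 2) ^ (s - j)
          * (s.choose j : ℝ) := by
    rw [sum_perm_succ fun m => ((m : ℝ) - ((n + 1 : ℕ) : ℝ) * (((n + 1 : ℕ) : ℝ) - 1) / 4) ^ s]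
    refine sum_congr rfl fun k _ => sum_congr rfl fun e _ => ?_
    rw [← add_pow]
    push_cast
    ring
  have h' : ∀ j ∈ range (s + 1), (s.choose j : ℝ) * invMoment j n * uniformMoment (s - j) n
      = (1 / ((n + 1).factorial : ℝ)) * ∑ k ∈ range (n + 1), ∑ e : Equiv.Perm (Fin n),
        ((invNum e : ℝ) - (n : ℝ) * ((n : ℝ) - 1) / 4) ^ j * ((k : ℝ) - n / 2) ^ (s - j)
          * (s.choose j : ℝ) := by
    intro j _
    rw [invMoment, uniformMoment, Nat.factorial_succ]
    simp only [← sum_mul, ← mul_sum]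
    push_cast
    rw [← one_div_mul_one_div]
    ring
  rw [invMoment, h, sum_congr rfl h', ← mul_sum]
  congr 1
  rw [sum_comm (s := range (s + 1))]
  exact sum_congr rfl fun k _ => sum_comm.symm

theorem uniformMoment_zero (n : ℕ) : uniformMoment 0 n = 1 := by
  have : (n : ℝ) + 1 ≠ 0 := by positivity
  simp [uniformMoment, this]

theorem uniformMoment_odd {s : ℕ} (hs : Odd s) (n : ℕ) : uniformMoment s n = 0 := by
  have h : ∑ k ∈ range (n + 1), ((k : ℝ) - n / 2) ^ s
      = -∑ k ∈ range (n + 1), ((k : ℝ) - n / 2) ^ s := by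
    conv_lhs => rw [← sum_range_reflect]
    rw [← sum_neg_distrib]
    refine sum_congr rfl fun k hk => ?_
    rw [mem_range] at hk
    rw [← hs.neg_pow, show n + 1 - 1 - k = n - k by omega, Nat.cast_sub (by omega)]
    ring
  rw [uniformMoment, show ∑ k ∈ range (n + 1), ((k : ℝ) - n / 2) ^ s = 0 by linarith, mul_zero]

theorem uniformMoment_two (n : ℕ) : uniformMoment 2 n = (n : ℝ) * (n + 2) / 12 := by
  have h : ∀ (m : ℕ) (c : ℝ), ∑ k ∈ range m, ((k : ℝ) - c) ^ 2
      = m * (m - 1) * (2 * m - 1) / 6 - c * m * (m - 1) + m * c ^ 2 := by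
    intro m c
    induction m with
    | zero => simp
    | succ m ih => rw [sum_range_succ, ih]; push_cast; ring
  have : (n : ℝ) + 1 ≠ 0 := by positivity
  rw [uniformMoment, h]
  push_cast
  field_simp
  ring

theorem abs_uniformMoment_le (s n : ℕ) : |uniformMoment s n| ≤ (n : ℝ) ^ s := by
  have hn : (0 : ℝ) < (n : ℝ) + 1 := by positivity
  have h : |∑ k ∈ range (n + 1), ((k : ℝ) - n / 2) ^ s| ≤ ((n : ℝ) + 1) * (n : ℝ) ^ s := by
    refine (abs_sum_le_sum_abs _ _).trans ?_
    refine (sum_le_card_nsmul _ _ ((n : ℝ) ^ s) fun k hk => ?_).trans (by simp)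
    rw [abs_pow]
    have hk' : (k : ℝ) ≤ n := by
      exact_mod_cast Nat.lt_succ_iff.mp (mem_range.mp hk)
    have hk0 : (0 : ℝ) ≤ k := k.cast_nonneg
    gcongr
    rw [abs_le]
    constructor <;> linarith
  rw [uniformMoment, abs_mul, abs_of_pos (by positivity), one_div, inv_mul_le_iff₀ hn]
  exact h

theorem invMoment_odd {s : ℕ} (hs : Odd s) (n : ℕ) : invMoment s n = 0 := by
  induction n generalizing s with
  | zero =>
    simp [invMoment, invNum, hs.pos.ne']
  | succ n ih =>
    rw [invMoment_succ]
    refine sum_eq_zero fun j hj => ?_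
    rw [mem_range] at hj
    rcases Nat.even_or_odd j with hj' | hj'
    · rw [uniformMoment_odd (Nat.Odd.sub_even (by omega) hs hj'), mul_zero]
    · rw [ih hj', mul_zero, zero_mul]

theorem tendsto_succ_pow_sub_pow_div (q : ℕ) :
    Tendsto (fun n : ℕ => (((n : ℝ) + 1) ^ (q + 1) - (n : ℝ) ^ (q + 1)) / (n : ℝ) ^ q)
      atTop (nhds ((q : ℝ) + 1)) := by
  have h1 : Tendsto (fun n : ℕ => 1 + 1 / (n : ℝ)) atTop (nhds 1) := by
    simpa using tendsto_one_div_atTop_nhds_zero_nat.const_add (1 : ℝ)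
  have h2 : Tendsto (fun n : ℕ => ∑ i ∈ range (q + 1), (1 + 1 / (n : ℝ)) ^ i) atTop
      (nhds ((q : ℝ) + 1)) := by
    simpa using tendsto_finsetSum (range (q + 1)) fun i _ => h1.pow i
  refine h2.congr' ?_
  filter_upwards [eventually_gt_atTop 0] with n hn
  have hn' : (n : ℝ) ≠ 0 := by positivity
  have hg := geom_sum₂_mul ((n : ℝ) + 1) n (q + 1)
  rw [add_sub_cancel_left, mul_one] at hg
  rw [← hg, sum_div]
  refine sum_congr rfl fun i hi => ?_
  rw [mem_range] at hi
  rw [show q + 1 - 1 - i = q - i by omega, eq_div_iff (by positivity),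
    ← Nat.add_sub_cancel' (show i ≤ q by omega), pow_add (n : ℝ) i, ← mul_assoc, ← mul_pow,
    Nat.add_sub_cancel_left]
  congr 2
  field_simp

/-- Stolz–Cesàro against powers of `n`. -/
theorem tendsto_div_pow_succ_of_sub {a : ℕ → ℝ} {q : ℕ} {L : ℝ}
    (h : Tendsto (fun n : ℕ => (a (n + 1) - a n) / (n : ℝ) ^ q) atTop (nhds L)) :
    Tendsto (fun n : ℕ => a n / (n : ℝ) ^ (q + 1)) atTop (nhds (L / ((q : ℝ) + 1))) := by
  set g : ℕ → ℝ := fun n => ((n : ℝ) + 1) ^ (q + 1) - (n : ℝ) ^ (q + 1) with hg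
  have hq : (q : ℝ) + 1 ≠ 0 := by positivity
  have hgpos : ∀ n, 0 < g n := fun n => by
    rw [hg]
    simp only [sub_pos]
    gcongr
    · simp
  have hgsum : ∀ n, ∑ i ∈ range n, g i = (n : ℝ) ^ (q + 1) := fun n => by
    have := sum_range_sub (fun i : ℕ => (i : ℝ) ^ (q + 1)) n
    simpa [hg] using this
  have hgt := tendsto_succ_pow_sub_pow_div q
  have hdiv : Tendsto (fun n => (a (n + 1) - a n - L / ((q : ℝ) + 1) * g n) / g n) atTop
      (nhds 0) := by
    have := (h.div hgt hq).sub_const (L / ((q : ℝ) + 1))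
    rw [sub_self] at this
    refine this.congr' ?_
    filter_upwards [eventually_gt_atTop 0] with n hn
    have hn' : (n : ℝ) ≠ 0 := by positivity
    have := (hgpos n).ne'
    rw [sub_div, mul_div_assoc, div_self this, mul_one]
    simp only [Pi.div_apply]
    rw [div_div_div_cancel_right₀ (pow_ne_zero _ hn')]
  have hlo := (Asymptotics.isLittleO_of_tendsto (fun n hn => absurd hn (hgpos n).ne')
    hdiv).sum_range (fun n => (hgpos n).le) (by
      simp only [hgsum]
      exact (tendsto_pow_atTop (Nat.succ_ne_zero q)).comp tendsto_natCast_atTop_atTop)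
  have hlim := hlo.tendsto_div_nhds_zero
  have ha : ∀ n, ∑ i ∈ range n, (a (i + 1) - a i - L / ((q : ℝ) + 1) * g i)
      = a n - a 0 - L / ((q : ℝ) + 1) * (n : ℝ) ^ (q + 1) := fun n => by
    rw [sum_sub_distrib, sum_range_sub, ← mul_sum, hgsum]
  simp only [ha, hgsum] at hlim
  have h0 : Tendsto (fun n : ℕ => a 0 / (n : ℝ) ^ (q + 1)) atTop (nhds 0) :=
    tendsto_const_nhds.div_atTop
      ((tendsto_pow_atTop (Nat.succ_ne_zero q)).comp tendsto_natCast_atTop_atTop)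
  have := (hlim.add h0).add_const (L / ((q : ℝ) + 1))
  rw [add_zero, zero_add] at this
  refine this.congr' ?_
  filter_upwards [eventually_gt_atTop 0] with n hn
  have hn' : (n : ℝ) ≠ 0 := by positivity
  field_simp
  ring

theorem tendsto_invMoment_even (r : ℕ) :
    Tendsto (fun n : ℕ => invMoment (2 * r) n / (n : ℝ) ^ (3 * r)) atTop
      (nhds (((2 * r).factorial : ℝ) / (r.factorial * 72 ^ r))) := by
  induction r using Nat.strong_induction_on with
  | _ r ih =>
    rcases r with _ | r
    · have : ∀ n, invMoment 0 n = 1 := fun n => by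
        have : (n.factorial : ℝ) ≠ 0 := by positivity
        simp [invMoment, Fintype.card_perm, this]
      simp [this]
    have hsmall : ∀ j ∈ range (2 * r), Tendsto (fun n : ℕ =>
        ((2 * r + 2).choose j : ℝ) * invMoment j n * uniformMoment (2 * r + 2 - j) n
          / (n : ℝ) ^ (3 * r + 2)) atTop (nhds 0) := by
      intro j hj
      rw [mem_range] at hj
      rcases Nat.even_or_odd' j with ⟨i, rfl | rfl⟩
      · have hlim := ((ih i (by omega)).const_mul ((2 * r + 2).choose (2 * i) : ℝ)).abs
        have hlim0 := hlim.mul tendsto_one_div_atTop_nhds_zero_nat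
        rw [mul_zero] at hlim0
        refine squeeze_zero_norm' ?_ hlim0
        filter_upwards [eventually_ge_atTop 1] with n hn
        have hn1 : (1 : ℝ) ≤ n := by exact_mod_cast hn
        have hn0 : (0 : ℝ) < n := by linarith
        rw [Real.norm_eq_abs, abs_div, abs_mul, abs_of_pos (pow_pos hn0 (3 * r + 2)),
          ← mul_div_assoc (((2 * r + 2).choose (2 * i) : ℕ) : ℝ), abs_div,
          abs_of_pos (pow_pos hn0 (3 * i)), div_mul_div_comm, mul_one,
          div_le_div_iff₀ (by positivity) (by positivity), mul_assoc]
        refine mul_le_mul_of_nonneg_left ?_ (abs_nonneg _)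
        calc |uniformMoment (2 * r + 2 - 2 * i) n| * ((n : ℝ) ^ (3 * i) * n)
            ≤ (n : ℝ) ^ (2 * r + 2 - 2 * i) * ((n : ℝ) ^ (3 * i) * n) := by
              gcongr
              exact abs_uniformMoment_le _ _
          _ = (n : ℝ) ^ (2 * r + 2 - 2 * i + (3 * i + 1)) := by ring
          _ ≤ (n : ℝ) ^ (3 * r + 2) := pow_le_pow_right₀ hn1 (by omega)
      · simp [invMoment_odd (odd_two_mul_add_one i)]
    have hsum := tendsto_finsetSum _ hsmall
    rw [sum_const_zero] at hsum
    have hu : Tendsto (fun n : ℕ => uniformMoment 2 n / (n : ℝ) ^ 2) atTop (nhds (1 / 12)) := by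
      have : Tendsto (fun n : ℕ => (1 + 2 * (1 / (n : ℝ))) / 12) atTop (nhds (1 / 12)) := by
        simpa using ((tendsto_one_div_atTop_nhds_zero_nat.const_mul (2 : ℝ)).const_add
          (1 : ℝ)).div_const 12
      refine this.congr' ?_
      filter_upwards [eventually_gt_atTop 0] with n hn
      have hn' : (n : ℝ) ≠ 0 := by positivity
      rw [uniformMoment_two]
      field_simp
    have hmain := ((ih r (by omega)).mul hu).const_mul ((2 * r + 2).choose (2 * r) : ℝ)
    have hdiff := hsum.add hmain
    rw [zero_add] at hdiff
    have hstolz := tendsto_div_pow_succ_of_sub (a := invMoment (2 * (r + 1))) (q := 3 * r + 2)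
      (hdiff.congr fun n => ?_)
    · rw [show 3 * (r + 1) = 3 * r + 2 + 1 by ring]
      convert hstolz using 2
      have hc : ((2 * r + 2).choose (2 * r) : ℝ) = (2 * r + 2) * (2 * r + 1) / 2 := by
        rw [← Nat.choose_symm (by omega), show 2 * r + 2 - 2 * r = 2 by omega,
          Nat.cast_choose_two]
        push_cast
        ring
      rw [hc, show 2 * (r + 1) = 2 * r + 1 + 1 by ring, Nat.factorial_succ, Nat.factorial_succ,
        Nat.factorial_succ]
      push_cast
      have : (r.factorial : ℝ) ≠ 0 := by positivity
      have : (3 * (r : ℝ) + 2 + 1) ≠ 0 := by positivity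
      field_simp
      ring
    · rw [invMoment_succ, show 2 * (r + 1) + 1 = 2 * r + 1 + 1 + 1 by ring, sum_range_succ,
        sum_range_succ, sum_range_succ, show 2 * (r + 1) = 2 * r + 2 by ring,
        show 2 * r + 2 - (2 * r + 1) = 1 by omega, uniformMoment_odd odd_one,
        show 2 * r + 1 + 1 = 2 * r + 2 by ring, Nat.sub_self, uniformMoment_zero,
        Nat.choose_self, show 2 * r + 2 - 2 * r = 2 by omega, ← sum_div, pow_add, div_mul_div_comm]
      push_cast
      ring

theorem invBinomMoment_eq_sum (s n : ℕ) :
    invBinomMoment s n = (1 / (s.factorial : ℝ)) * ∑ k ∈ range (s + 1),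
      (∏ j ∈ range s, (Polynomial.X - Polynomial.C (j : ℝ))).coeff k * invMoment k n := by
  have hdeg : (∏ j ∈ range s, (Polynomial.X - Polynomial.C (j : ℝ))).natDegree = s := by
    rw [Polynomial.natDegree_finsetProd_X_sub_C_eq_card, card_range]
  have heval : ∀ x : ℝ, ∏ j ∈ range s, (x - (j : ℝ)) = ∑ k ∈ range (s + 1),
      (∏ j ∈ range s, (Polynomial.X - Polynomial.C (j : ℝ))).coeff k * x ^ k := fun x => by
    have := Polynomial.eval_eq_sum_range
      (p := ∏ j ∈ range s, (Polynomial.X - Polynomial.C (j : ℝ))) x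
    rw [hdeg, Polynomial.eval_prod] at this
    simpa using this
  simp only [invBinomMoment, invMoment, heval]
  rw [← mul_sum, sum_comm, mul_left_comm, mul_sum]
  congr 1
  refine sum_congr rfl fun k _ => ?_
  rw [← mul_sum]
  ring

theorem coeff_prod_X_sub_C_range (m : ℕ) :
    (∏ j ∈ range (m + 1), (Polynomial.X - Polynomial.C (j : ℝ))).coeff m
      = -((m : ℝ) * (m + 1) / 2) := by
  have h := Polynomial.prod_X_sub_C_coeff_card_pred (range (m + 1)) (fun j : ℕ => (j : ℝ))
    (by simp)
  rw [card_range, Nat.add_sub_cancel] at h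
  rw [h, ← Nat.cast_sum, eq_comm, neg_inj, div_eq_iff two_ne_zero]
  have := sum_range_id_mul_two (m + 1)
  rw [Nat.add_sub_cancel] at this
  rw [mul_comm]
  exact_mod_cast this.symm

/-- For `r ≥ 1`, the odd binomial moments of the inversion number satisfy
`lim_{n→∞} B_{2r+1}(n) · (r−1)! · 72^r / n^{3r} = −1`, i.e.
`B_{2r+1}(n) = −n^{3r}/((r−1)! · 2^{3r} · 3^{2r})` plus lower order terms. -/
theorem invBinomMoment_odd_leading (r : ℕ) (hr : 1 ≤ r) :
    Tendsto (fun n : ℕ =>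
        invBinomMoment (2 * r + 1) n * ((r - 1).factorial : ℝ) * 72 ^ r / (n : ℝ) ^ (3 * r))
      atTop (nhds (-1)) := by
  set c : ℕ → ℝ := fun k =>
    (∏ j ∈ range (2 * r + 1), (Polynomial.X - Polynomial.C (j : ℝ))).coeff k with hc
  have hsmall : ∀ k ∈ range (2 * r), Tendsto (fun n : ℕ =>
      c k * invMoment k n / (n : ℝ) ^ (3 * r)) atTop (nhds 0) := by
    intro k hk
    rw [mem_range] at hk
    rcases Nat.even_or_odd' k with ⟨i, rfl | rfl⟩
    · have hpow : Tendsto (fun n : ℕ => 1 / (n : ℝ) ^ (3 * r - 3 * i)) atTop (nhds 0) :=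
        tendsto_const_nhds.div_atTop
          ((tendsto_pow_atTop (by omega)).comp tendsto_natCast_atTop_atTop)
      have := ((tendsto_invMoment_even i).const_mul (c (2 * i))).mul hpow
      rw [mul_zero] at this
      refine this.congr fun n => ?_
      rw [← mul_div_assoc (c (2 * i)), div_mul_div_comm, mul_one, ← pow_add,
        show 3 * i + (3 * r - 3 * i) = 3 * r by omega]
    · simp [invMoment_odd (odd_two_mul_add_one i)]
  have hsum := tendsto_finsetSum _ hsmall
  rw [sum_const_zero] at hsum
  have hlim := ((hsum.add ((tendsto_invMoment_even r).const_mul (c (2 * r)))).const_mul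
    (1 / ((2 * r + 1).factorial : ℝ))).mul_const (((r - 1).factorial : ℝ) * 72 ^ r)
  have hval : 1 / ((2 * r + 1).factorial : ℝ) * (0 + c (2 * r) *
      (((2 * r).factorial : ℝ) / (r.factorial * 72 ^ r))) * (((r - 1).factorial : ℝ) * 72 ^ r)
      = -1 := by
    obtain ⟨m, rfl⟩ : ∃ m, r = m + 1 := ⟨r - 1, by omega⟩
    rw [hc]
    simp only [coeff_prod_X_sub_C_range, Nat.add_sub_cancel]
    rw [Nat.factorial_succ (2 * (m + 1)), Nat.factorial_succ m]
    have : (m.factorial : ℝ) ≠ 0 := by positivity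
    have : ((2 * (m + 1)).factorial : ℝ) ≠ 0 := by positivity
    have : (m : ℝ) + 1 ≠ 0 := by positivity
    have : 2 * ((m : ℝ) + 1) + 1 ≠ 0 := by positivity
    push_cast
    field_simp
    ring
  rw [hval] at hlim
  refine hlim.congr fun n => ?_
  rw [invBinomMoment_eq_sum, sum_range_succ, sum_range_succ,
    invMoment_odd (odd_two_mul_add_one r), ← sum_div]
  simp only [hc]
  ring
end

section
/- Let r ≥ 1 and t ≥ 0 be integers such that either r is odd and 0 ≤ t ≤ r, or r is even and 0 ≤ t < r/2. Then Σ_{i=t}^{r} (−1/2)^{r−i} · C(r,i) · Σ_{j=i−t}^{i} 2^{−j} · S(i,j) · s(j, i−t) = 0, where C(r,i) is the binomial coefficient. -/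
open Finset

/-- Stirling numbers of the second kind: `S(0,0)=1`, `S(i,0)=0` for `i ≥ 1`, `S(0,j)=0` for
`j ≥ 1`, and `S(i,j) = j·S(i−1,j) + S(i−1,j−1)`. -/
def stirling2 : ℕ → ℕ → ℕ
  | 0, 0 => 1
  | 0, _ + 1 => 0
  | _ + 1, 0 => 0
  | i + 1, j + 1 => (j + 1) * stirling2 i (j + 1) + stirling2 i j

/-- Signed Stirling numbers of the first kind: `s(j,m)` is the coefficient of `x^m` in
`∏_{t=0}^{j−1}(x−t)`. -/
noncomputable def stirling1 (j m : ℕ) : ℤ :=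
  (∏ t ∈ Finset.range j, (Polynomial.X - Polynomial.C (t : ℤ))).coeff m

open Polynomial

lemma sum_choose_mul_descFactorial (n j : ℕ) :
    2 ^ j * ∑ k ∈ range (n + 1), n.choose k * k.descFactorial j = 2 ^ n * n.descFactorial j := by
  induction j generalizing n with
  | zero => simp [Nat.sum_range_choose]
  | succ j ih =>
    cases n with
    | zero => simp
    | succ n =>
      rw [sum_range_succ']
      have key : ∀ k, (n + 1).choose (k + 1) * (k + 1).descFactorial (j + 1) =
          (n + 1) * (n.choose k * k.descFactorial j) := fun k => by
        rw [Nat.succ_descFactorial_succ, ← mul_assoc, ← Nat.add_one_mul_choose_eq, mul_assoc]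
      rw [sum_congr rfl fun k _ => key k, ← mul_sum]
      simp only [Nat.zero_descFactorial_succ, mul_zero, add_zero,
        Nat.succ_descFactorial_succ]
      linear_combination 2 * (n + 1) * ih n

lemma stirling2_eq_zero_of_lt {i j : ℕ} (h : i < j) : stirling2 i j = 0 := by
  induction i generalizing j with
  | zero =>
    obtain ⟨j, rfl⟩ := Nat.exists_eq_succ_of_ne_zero h.ne'
    rfl
  | succ i ih =>
    obtain ⟨j, rfl⟩ := Nat.exists_eq_succ_of_ne_zero (Nat.ne_zero_of_lt h)
    rw [stirling2, ih (by omega), ih (by omega)]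
    simp

lemma sum_stirling2_mul_descFactorial (i k : ℕ) :
    ∑ j ∈ range (i + 1), stirling2 i j * k.descFactorial j = k ^ i := by
  induction i with
  | zero => simp [stirling2]
  | succ i ih =>
    rw [sum_range_succ']
    simp only [stirling2, zero_mul, add_zero, add_mul (_ * _), sum_add_distrib]
    have shift := sum_range_succ' (fun j => j * stirling2 i j * k.descFactorial j) (i + 1)
    rw [sum_range_succ, stirling2_eq_zero_of_lt (Nat.lt_succ_self i)] at shift
    simp only [mul_zero, zero_mul, add_zero] at shift
    rw [← shift, ← sum_add_distrib, pow_succ, ← ih, sum_mul]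
    refine sum_congr rfl fun j _ => ?_
    obtain hjk | hkj := le_or_gt j k
    · obtain ⟨d, rfl⟩ := Nat.exists_eq_add_of_le hjk
      rw [Nat.descFactorial_succ, Nat.add_sub_cancel_left]
      ring
    · simp [Nat.descFactorial_of_lt hkj]

lemma stirling1_eq_coeff_descPochhammer (j m : ℕ) :
    (stirling1 j m : ℚ) = (descPochhammer ℚ j).coeff m := by
  have h : ∀ j, ∏ t ∈ range j, (X - C (t : ℤ)) = descPochhammer ℤ j := fun j => by
    induction j with
    | zero => simp
    | succ j ih => rw [prod_range_succ, ih, descPochhammer_succ_right, C_eq_natCast]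
  rw [stirling1, h, ← descPochhammer_map (Int.castRingHom ℚ), coeff_map, eq_intCast]

/-- The polynomial whose value at `n : ℕ` is the `i`-th moment of the binomial distribution
with parameters `n` and `1 / 2`. -/
noncomputable def binomialMoment (i : ℕ) : ℚ[X] :=
  ∑ j ∈ range (i + 1), C ((1 / 2 : ℚ) ^ j * (stirling2 i j : ℚ)) * descPochhammer ℚ j

/-- The polynomial whose value at `n : ℕ` is the `r`-th central moment of the binomial
distribution with parameters `n` and `1 / 2`. -/
noncomputable def binomialCentralMoment (r : ℕ) : ℚ[X] :=
  ∑ i ∈ range (r + 1), C ((-1 / 2 : ℚ) ^ (r - i) * (r.choose i : ℚ)) * X ^ (r - i) *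
    binomialMoment i

lemma eval_binomialMoment (i n : ℕ) :
    (binomialMoment i).eval (n : ℚ) =
      (1 / 2) ^ n * ∑ k ∈ range (n + 1), (n.choose k : ℚ) * (k : ℚ) ^ i := by
  have h (j : ℕ) : (1 / 2 : ℚ) ^ j * (n.descFactorial j : ℚ) =
      (1 / 2) ^ n * ∑ k ∈ range (n + 1), (n.choose k : ℚ) * (k.descFactorial j : ℚ) := by
    have h' : (2 : ℚ) ^ j * ∑ k ∈ range (n + 1), (n.choose k : ℚ) * (k.descFactorial j : ℚ) =
        2 ^ n * (n.descFactorial j : ℚ) := mod_cast sum_choose_mul_descFactorial n j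
    rw [one_div, inv_pow, inv_pow]
    field_simp
    linear_combination -h'
  simp only [binomialMoment, eval_finsetSum, eval_mul, eval_C,
    descPochhammer_eval_eq_descFactorial]
  calc _ = ∑ j ∈ range (i + 1), (stirling2 i j : ℚ) *
        ((1 / 2 : ℚ) ^ j * (n.descFactorial j : ℚ)) := sum_congr rfl fun j _ => by ring
    _ = (1 / 2) ^ n * ∑ k ∈ range (n + 1), (n.choose k : ℚ) *
        ∑ j ∈ range (i + 1), (stirling2 i j : ℚ) * (k.descFactorial j : ℚ) := by
      simp only [h, mul_sum]
      rw [sum_comm]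
      exact sum_congr rfl fun _ _ => sum_congr rfl fun _ _ => by ring
    _ = _ := by
      congr 1
      refine sum_congr rfl fun k _ => ?_
      congr 1
      exact_mod_cast sum_stirling2_mul_descFactorial i k

lemma eval_binomialCentralMoment (r n : ℕ) :
    (binomialCentralMoment r).eval (n : ℚ) =
      (1 / 2) ^ n * ∑ k ∈ range (n + 1), (n.choose k : ℚ) * ((k : ℚ) - n / 2) ^ r := by
  simp only [binomialCentralMoment, eval_finsetSum, eval_mul, eval_C, eval_pow, eval_X,
    eval_binomialMoment, sub_eq_add_neg, add_pow, mul_sum]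
  rw [sum_comm]
  refine sum_congr rfl fun k _ => sum_congr rfl fun i _ => ?_
  rw [show -((n : ℚ) / 2) = -1 / 2 * n by ring, mul_pow]
  ring

lemma eq_of_eval_natCast_eq {p q : ℚ[X]} (h : ∀ n : ℕ, p.eval (n : ℚ) = q.eval (n : ℚ)) :
    p = q :=
  eq_of_infinite_eval_eq p q <|
    (Set.infinite_range_of_injective (Nat.cast_injective (R := ℚ))).mono <| by
      rintro _ ⟨n, rfl⟩
      exact h n

lemma binomialCentralMoment_of_odd {r : ℕ} (hr : Odd r) : binomialCentralMoment r = 0 := by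
  refine eq_of_eval_natCast_eq fun n => ?_
  rw [eval_binomialCentralMoment, eval_zero]
  have h : ∑ k ∈ range (n + 1), (n.choose k : ℚ) * ((k : ℚ) - n / 2) ^ r =
      -∑ k ∈ range (n + 1), (n.choose k : ℚ) * ((k : ℚ) - n / 2) ^ r := by
    conv_lhs => rw [← sum_range_reflect]
    rw [← sum_neg_distrib]
    refine sum_congr rfl fun k hk => ?_
    have hk : k ≤ n := Nat.lt_succ_iff.mp (mem_range.mp hk)
    rw [Nat.add_sub_cancel, Nat.choose_symm hk, Nat.cast_sub hk, ← mul_neg, ← hr.neg_pow]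
    ring
  rw [self_eq_neg.mp h, mul_zero]

lemma eval_binomialCentralMoment_add_two (r n : ℕ) :
    (binomialCentralMoment (r + 2)).eval ((n + 2 : ℕ) : ℚ) =
      ((n : ℚ) + 2) ^ 2 / 4 * (binomialCentralMoment r).eval ((n + 2 : ℕ) : ℚ) -
        (n + 2) * (n + 1) / 4 * (binomialCentralMoment r).eval (n : ℚ) := by
  simp only [eval_binomialCentralMoment]
  have h : ∑ k ∈ range (n + 3), (k : ℚ) * (n + 2 - k) * ((n + 2).choose k : ℚ) *
        ((k : ℚ) - (n + 2) / 2) ^ r =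
      (n + 2) * (n + 1) * ∑ k ∈ range (n + 1), (n.choose k : ℚ) * ((k : ℚ) - n / 2) ^ r := by
    rw [sum_range_succ, sum_range_succ', mul_sum]
    push_cast
    simp only [sub_self, mul_zero, zero_mul, add_zero]
    refine sum_congr rfl fun k hk => ?_
    have hk : k ≤ n := Nat.lt_succ_iff.mp (mem_range.mp hk)
    have h₁ : ((n : ℚ) + 2) * ((n + 1).choose k : ℚ) = ((n + 2).choose (k + 1) : ℚ) * (k + 1) :=
      mod_cast Nat.add_one_mul_choose_eq (n + 1) k
    have h₂ : (n.choose k : ℚ) * (n + 1) = ((n + 1).choose k : ℚ) * (n + 1 - k) := by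
      have := congrArg (Nat.cast (R := ℚ)) (Nat.choose_mul_succ_eq n k)
      rw [Nat.cast_mul, Nat.cast_mul, Nat.cast_sub (by omega)] at this
      exact_mod_cast this
    rw [show (k : ℚ) + 1 - (n + 2) / 2 = k - n / 2 by ring]
    linear_combination (-(((n : ℚ) + 1 - k) * h₁) - ((n : ℚ) + 2) * h₂) * ((k : ℚ) - n / 2) ^ r
  have h' : ∑ k ∈ range (n + 3), ((n + 2).choose k : ℚ) * ((k : ℚ) - (n + 2) / 2) ^ (r + 2) =
      ((n : ℚ) + 2) ^ 2 / 4 *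
        ∑ k ∈ range (n + 3), ((n + 2).choose k : ℚ) * ((k : ℚ) - (n + 2) / 2) ^ r -
      ∑ k ∈ range (n + 3), (k : ℚ) * (n + 2 - k) * ((n + 2).choose k : ℚ) *
        ((k : ℚ) - (n + 2) / 2) ^ r := by
    rw [mul_sum, ← sum_sub_distrib]
    exact sum_congr rfl fun k _ => by ring
  push_cast
  rw [show n + 2 + 1 = n + 3 from rfl, h', h]
  ring

lemma binomialCentralMoment_add_two (r : ℕ) :
    binomialCentralMoment (r + 2) =
      C (1 / 4) * (X ^ 2 * (binomialCentralMoment r - taylor (-2) (binomialCentralMoment r)) +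
        X * taylor (-2) (binomialCentralMoment r)) := by
  apply taylor_injective (2 : ℚ)
  refine eq_of_eval_natCast_eq fun n => ?_
  have h := eval_binomialCentralMoment_add_two r n
  push_cast at h
  simp only [taylor_eval, eval_mul, eval_add, eval_sub, eval_C, eval_pow, eval_X, h,
    add_neg_cancel_right]
  ring

lemma natDegree_X_mul_sub_taylor_le {R : Type*} [CommRing R] (p : R[X]) (a : R) :
    (X * (p - taylor a p)).natDegree ≤ p.natDegree := by
  rcases eq_or_ne (p - taylor a p) 0 with h0 | h0
  · simp [h0]
  have hp : p ≠ 0 := by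
    rintro rfl
    simp at h0
  have hlt := natDegree_lt_natDegree h0
    (degree_sub_lt_left (degree_taylor p a).symm hp (leadingCoeff_taylor a p).symm)
  have hX : (X : R[X]).natDegree ≤ 1 := natDegree_X_le
  exact natDegree_mul_le.trans (by omega)

lemma natDegree_binomialCentralMoment_le (m : ℕ) :
    (binomialCentralMoment (2 * m)).natDegree ≤ m := by
  induction m with
  | zero => simp [binomialCentralMoment, binomialMoment, stirling2]
  | succ m ih =>
    rw [mul_add, mul_one, binomialCentralMoment_add_two, pow_two, mul_assoc, ← mul_add]
    refine (natDegree_C_mul_le _ _).trans (natDegree_mul_le.trans ?_)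
    rw [natDegree_X, add_comm]
    refine Nat.add_le_add_right (natDegree_add_le_of_degree_le
      ((natDegree_X_mul_sub_taylor_le _ _).trans ih) ?_) 1
    rwa [natDegree_taylor]

lemma coeff_binomialCentralMoment {r t : ℕ} (ht : t ≤ r) :
    (binomialCentralMoment r).coeff (r - t) =
      ∑ i ∈ Icc t r, (-1 / 2 : ℚ) ^ (r - i) * (r.choose i : ℚ) *
        ∑ j ∈ Icc (i - t) i,
          (1 / 2 : ℚ) ^ j * (stirling2 i j : ℚ) * (stirling1 j (i - t) : ℚ) := by
  simp only [binomialCentralMoment, finsetSum_coeff, mul_assoc, coeff_C_mul, coeff_X_pow_mul']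
  symm
  refine sum_subset_zero_on_sdiff (fun i hi => ?_) (fun i hi => ?_) fun i hi => ?_
  · simp only [mem_Icc, mem_range] at hi ⊢
    omega
  · simp only [mem_sdiff, mem_Icc, mem_range] at hi
    rw [if_neg (by omega)]
    simp
  · rw [mem_Icc] at hi
    rw [if_pos (by omega), show r - t - (r - i) = i - t by omega, binomialMoment,
      finsetSum_coeff]
    congr 2
    refine sum_subset_zero_on_sdiff (fun j hj => ?_) (fun j hj => ?_) fun j _ => ?_
    · simp only [mem_Icc, mem_range] at hj ⊢
      omega
    · simp only [mem_sdiff, mem_Icc, mem_range] at hj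
      rw [coeff_C_mul, coeff_eq_zero_of_natDegree_lt, mul_zero]
      rw [descPochhammer_natDegree]
      omega
    · rw [coeff_C_mul, stirling1_eq_coeff_descPochhammer, mul_assoc]

/-- Let `r ≥ 1` and `t ≥ 0` with either `r` odd and `0 ≤ t ≤ r`, or `r` even and `0 ≤ t < r/2`.
Then `Σ_{i=t}^{r} (−1/2)^{r−i} C(r,i) Σ_{j=i−t}^{i} 2^{−j} S(i,j) s(j,i−t) = 0`. -/
theorem stirling_identity_vanishing (r t : ℕ) (hr : 1 ≤ r)
    (h : (Odd r ∧ t ≤ r) ∨ (Even r ∧ 2 * t < r)) :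
    ∑ i ∈ Finset.Icc t r, (-1 / 2 : ℚ) ^ (r - i) * (r.choose i : ℚ) *
        ∑ j ∈ Finset.Icc (i - t) i,
          (1 / 2 : ℚ) ^ j * (stirling2 i j : ℚ) * (stirling1 j (i - t) : ℚ) = 0 := by
  rw [← coeff_binomialCentralMoment (by omega)]
  obtain ⟨hodd, -⟩ | ⟨heven, ht⟩ := h
  · rw [binomialCentralMoment_of_odd hodd, coeff_zero]
  · obtain ⟨m, rfl⟩ := heven.two_dvd
    exact coeff_eq_zero_of_natDegree_lt
      ((natDegree_binomialCentralMoment_le m).trans_lt (by omega))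
end
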